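/- (Theorem 3.1) Let Ĉ be as in the context and λ ∈ ℂ. Define B₀ := A − λI, a continuous matrix function of k ∈ [-π,π]^N; and recursively, for j = 1,…,N, whenever det B_i is nowhere zero for all 0 ≤ i ≤ j−1, define B_j := I + ⟨B_{j-1}^{-1} ⋯ B₁^{-1} B₀^{-1} A_j⟩_{1…j}, a continuous matrix function of (k_{j+1},…,k_N) (so B_N is a constant matrix). Then λ belongs to the spectrum of Ĉ if and only if there exists j ∈ {0,1,…,N} such that det B_i(k) ≠ 0 for all k and all 0 ≤ i ≤ j−1, while det B_j(k) = 0 for some k ∈ [-π,π]^{N-j}. Equivalently, λ ∉ spec(Ĉ) if and only if each B_j, j = 0,…,N, is defined and has nowhere-vanishing determinant. -/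

import Mathlib

open MeasureTheory

noncomputable section

/-- The box `[-π, π]^N`. -/
def box (N : ℕ) : Set (Fin N → ℝ) := Set.univ.pi fun _ => Set.Icc (-Real.pi) Real.pi

/-- Lebesgue measure restricted to the box `[-π, π]^N`. -/
def boxMeasure (N : ℕ) : Measure (Fin N → ℝ) := MeasureTheory.volume.restrict (box N)

/-- `L²_M`: square-integrable `ℂ^M`-valued functions on `[-π, π]^N`. -/
abbrev L2M (N M : ℕ) : Type := MeasureTheory.Lp (EuclideanSpace ℂ (Fin M)) 2 (boxMeasure N)

/-- `ℓ²(ℤ^N, ℂ^M)`. -/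
abbrev ell2 (N M : ℕ) : Type := lp (fun _ : Fin N → ℤ => EuclideanSpace ℂ (Fin M)) 2

/-- The values of the Bloch–Floquet transform:
`(F h)(k) = (2π)^{-N/2} Σ_{n ∈ ℤ^N} h(n) e^{i n·k}`. -/
def blochFormula {N M : ℕ} (h : (Fin N → ℤ) → EuclideanSpace ℂ (Fin M)) (k : Fin N → ℝ) :
    EuclideanSpace ℂ (Fin M) :=
  ((2 * Real.pi) ^ ((N : ℝ) / 2))⁻¹ •
    ∑' n : Fin N → ℤ, Complex.exp (Complex.I * ∑ i, (n i : ℂ) * (k i : ℂ)) • h n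
/-- The (unnormalized) partial integral over the first `j` variables:
`(pint j f)(k) = ∫_{[-π,π]^j} f(t₁,…,t_j,k_{j+1},…,k_N) dt₁⋯dt_j`. -/
def pint {N M : ℕ} (j : ℕ) (f : (Fin N → ℝ) → EuclideanSpace ℂ (Fin M))
    (k : Fin N → ℝ) : EuclideanSpace ℂ (Fin M) :=
  ∫ t : Fin j → ℝ in (Set.univ.pi fun _ => Set.Icc (-Real.pi) Real.pi),
    f fun i => if h : (i : ℕ) < j then t ⟨(i : ℕ), h⟩ else k i

/-- The normalized partial average
`⟨f⟩_{1…j}(k) = (2π)^{-j/2} ∫_{[-π,π]^j} f(t₁,…,t_j,k_{j+1},…,k_N) dt₁⋯dt_j`. -/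
def navg {N M : ℕ} (j : ℕ) (f : (Fin N → ℝ) → EuclideanSpace ℂ (Fin M))
    (k : Fin N → ℝ) : EuclideanSpace ℂ (Fin M) :=
  ((2 * Real.pi) ^ ((j : ℝ) / 2))⁻¹ • pint j f k

/-- The recursive sequence of the matrices of Theorem 3.1, together with the accumulated
product of inverses: `Bseq … j = (B_j, B_{j-1}⁻¹⋯B₁⁻¹B₀⁻¹)`, where `B₀(k) = A(k) − λI` and
`B_j = I + ⟨B_{j-1}⁻¹⋯B₁⁻¹B₀⁻¹ A_j⟩_{1…j}` (the normalized integral `⟨·⟩_{1…j}` over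
`k₁,…,k_j ∈ [-π,π]^j` being taken entrywise; matrix inversion is Mathlib's total inverse,
which agrees with the true inverse wherever the determinants do not vanish). -/
def Bseq {N M : ℕ} (A : (Fin N → ℝ) → Matrix (Fin M) (Fin M) ℂ)
    (AA : ℕ → (Fin N → ℝ) → Matrix (Fin M) (Fin M) ℂ) (lam : ℂ) :
    ℕ → ((Fin N → ℝ) → Matrix (Fin M) (Fin M) ℂ) × ((Fin N → ℝ) → Matrix (Fin M) (Fin M) ℂ)
  | 0 => (fun k => A k - lam • 1, fun _ => 1)
  | (j+1) =>
      (fun k => 1 + Matrix.of fun a b =>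
          ((2 * Real.pi) ^ (((j : ℝ) + 1) / 2))⁻¹ *
            ∫ t : Fin (j+1) → ℝ in (Set.univ.pi fun _ => Set.Icc (-Real.pi) Real.pi),
              ((((Bseq A AA lam j).1
                    (fun i => if h : (i : ℕ) < j+1 then t ⟨(i : ℕ), h⟩ else k i))⁻¹
                * (Bseq A AA lam j).2
                    (fun i => if h : (i : ℕ) < j+1 then t ⟨(i : ℕ), h⟩ else k i)
                * AA (j+1)
                    (fun i => if h : (i : ℕ) < j+1 then t ⟨(i : ℕ), h⟩ else k i)) a b),
       fun k => ((Bseq A AA lam j).1 k)⁻¹ * (Bseq A AA lam j).2 k)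


/-- Replace the first `j` coordinates of `k` by `t`. -/
def merge {N : ℕ} (j : ℕ) (t : Fin j → ℝ) (k : Fin N → ℝ) : Fin N → ℝ :=
  fun i => if h : (i : ℕ) < j then t ⟨(i : ℕ), h⟩ else k i

section Merge

variable {N j : ℕ}

theorem merge_congr (t : Fin j → ℝ) {k k' : Fin N → ℝ} (h : ∀ i : Fin N, j ≤ (i : ℕ) → k i = k' i) :
    merge j t k = merge j t k' := by
  funext i
  by_cases hi : (i : ℕ) < j
  · simp [merge, hi]
  · simp [merge, hi, h i (not_lt.mp hi)]

theorem merge_apply_of_le (t : Fin j → ℝ) (k : Fin N → ℝ) {i : Fin N} (hi : j ≤ (i : ℕ)) :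
    merge j t k i = k i := by
  simp [merge, not_lt.mpr hi]

theorem merge_mem_box {t : Fin j → ℝ} {k : Fin N → ℝ} (ht : t ∈ box j) (hk : k ∈ box N) :
    merge j t k ∈ box N := by
  intro i _
  by_cases hi : (i : ℕ) < j
  · simpa [merge, hi] using ht ⟨i, hi⟩ trivial
  · simpa [merge, hi] using hk i trivial

theorem merge_merge {i : ℕ} (hji : j ≤ i) (t : Fin j → ℝ) (s : Fin i → ℝ) (k : Fin N → ℝ) :
    merge j t (merge i s k) = merge i (merge j t s) k := by
  funext l
  by_cases h1 : (l : ℕ) < j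
  · simp [merge, h1, h1.trans_le hji]
  · by_cases h2 : (l : ℕ) < i <;> simp [merge, h1, h2]

theorem continuous_merge :
    Continuous fun p : (Fin N → ℝ) × (Fin j → ℝ) => merge j p.2 p.1 := by
  refine continuous_pi fun i => ?_
  by_cases hi : (i : ℕ) < j
  · simp only [merge, hi, dite_true]; fun_prop
  · simp only [merge, hi, dite_false]; fun_prop

theorem isCompact_box : IsCompact (box N) :=
  isCompact_univ_pi fun _ => isCompact_Icc

theorem measurableSet_box : MeasurableSet (box N) := isCompact_box.measurableSet

theorem boxMeasure_eq_pi :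
    boxMeasure N = Measure.pi fun _ : Fin N => volume.restrict (Set.Icc (-Real.pi) Real.pi) := by
  rw [boxMeasure, box, volume_pi, Measure.restrict_pi_pi]

instance : IsFiniteMeasure (boxMeasure N) := by
  rw [boxMeasure_eq_pi]; infer_instance

theorem ae_mem_box : ∀ᵐ k ∂boxMeasure N, k ∈ box N := ae_restrict_mem measurableSet_box

theorem boxMeasure_univ : boxMeasure N Set.univ = ENNReal.ofReal (2 * Real.pi) ^ N := by
  rw [boxMeasure_eq_pi, Measure.pi_univ]
  simp [two_mul]

theorem boxMeasure_real_univ : (boxMeasure N).real Set.univ = (2 * Real.pi) ^ N := by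
  rw [Measure.real, boxMeasure_univ, ENNReal.toReal_pow,
    ENNReal.toReal_ofReal (by positivity)]

theorem map_merge (hj : j ≤ N) :
    Measure.map (fun p : (Fin N → ℝ) × (Fin j → ℝ) => merge j p.2 p.1)
      ((boxMeasure N).prod (boxMeasure j)) = ENNReal.ofReal (2 * Real.pi) ^ j • boxMeasure N := by
  have hc0 : ENNReal.ofReal (2 * Real.pi) ^ j ≠ 0 :=
    pow_ne_zero _ (by simp [Real.pi_pos])
  have hct : ENNReal.ofReal (2 * Real.pi) ^ j ≠ ⊤ := ENNReal.pow_ne_top ENNReal.ofReal_ne_top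
  suffices h : boxMeasure N = (ENNReal.ofReal (2 * Real.pi) ^ j)⁻¹ •
      Measure.map (fun p : (Fin N → ℝ) × (Fin j → ℝ) => merge j p.2 p.1)
      ((boxMeasure N).prod (boxMeasure j)) by
    conv_rhs => rw [h, smul_smul, ENNReal.mul_inv_cancel hc0 hct, one_smul]
  obtain ⟨n, rfl⟩ := Nat.exists_eq_add_of_le hj
  conv_lhs => rw [boxMeasure_eq_pi]
  refine Measure.pi_eq fun s hs => ?_
  rw [Measure.smul_apply, Measure.map_apply continuous_merge.measurable
    (MeasurableSet.univ_pi hs)]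
  have hpre : (fun p : (Fin (j + n) → ℝ) × (Fin j → ℝ) => merge j p.2 p.1) ⁻¹' Set.univ.pi s =
      (Set.univ.pi fun i : Fin (j + n) => if (i : ℕ) < j then Set.univ else s i) ×ˢ
        Set.univ.pi fun i : Fin j => s (Fin.castAdd n i) := by
    ext ⟨k, t⟩
    simp only [Set.mem_preimage, Set.mem_pi, Set.mem_univ, true_imp_iff, Set.mem_prod]
    constructor
    · refine fun h => ⟨fun i => ?_, fun i => ?_⟩
      · by_cases hi : (i : ℕ) < j
        · simp [hi]
        · simpa [merge, hi] using h i
      · simpa [merge] using h (Fin.castAdd n i)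
    · rintro ⟨h1, h2⟩ i
      by_cases hi : (i : ℕ) < j
      · simpa [merge, hi] using h2 ⟨i, hi⟩
      · simpa [merge, hi] using h1 i
  rw [hpre, Measure.prod_prod, boxMeasure_eq_pi, boxMeasure_eq_pi, Measure.pi_pi, Measure.pi_pi,
    Fin.prod_univ_add, Fin.prod_univ_add]
  have hvol : volume (Set.Icc (-Real.pi) Real.pi) = ENNReal.ofReal (2 * Real.pi) := by
    simp [two_mul]
  simp only [Fin.val_castAdd, Fin.is_lt, if_true, Fin.val_natAdd, Measure.restrict_apply_univ,
    hvol, Finset.prod_const, Finset.card_univ, Fintype.card_fin, smul_eq_mul,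
    not_lt.mpr (Nat.le_add_right _ _), if_false]
  rw [mul_assoc, ← mul_assoc, ENNReal.inv_mul_cancel hc0 hct, one_mul, mul_comm]

theorem quasiMeasurePreserving_merge (hj : j ≤ N) :
    Measure.QuasiMeasurePreserving (fun p : (Fin N → ℝ) × (Fin j → ℝ) => merge j p.2 p.1)
      ((boxMeasure N).prod (boxMeasure j)) (boxMeasure N) := by
  refine ⟨continuous_merge.measurable, ?_⟩
  rw [map_merge hj]
  exact Measure.smul_absolutelyContinuous

theorem ae_ae_merge (hj : j ≤ N) {p : (Fin N → ℝ) → Prop} (h : ∀ᵐ k ∂boxMeasure N, p k) :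
    ∀ᵐ k ∂boxMeasure N, ∀ᵐ t ∂boxMeasure j, p (merge j t k) :=
  Measure.ae_ae_of_ae_prod ((quasiMeasurePreserving_merge hj).ae h)

variable {E : Type*} [NormedAddCommGroup E] {f : (Fin N → ℝ) → E}

theorem integrable_comp_merge (hj : j ≤ N) (hf : Integrable f (boxMeasure N)) :
    Integrable (fun p : (Fin N → ℝ) × (Fin j → ℝ) => f (merge j p.2 p.1))
      ((boxMeasure N).prod (boxMeasure j)) := by
  have h : Integrable f (Measure.map (fun p : (Fin N → ℝ) × (Fin j → ℝ) => merge j p.2 p.1)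
      ((boxMeasure N).prod (boxMeasure j))) := by
    rw [map_merge hj]
    exact hf.smul_measure (ENNReal.pow_ne_top ENNReal.ofReal_ne_top)
  exact (integrable_map_measure h.1 continuous_merge.measurable.aemeasurable).1 h

theorem ae_integrable_merge (hj : j ≤ N) (hf : Integrable f (boxMeasure N)) :
    ∀ᵐ k ∂boxMeasure N, Integrable (fun t => f (merge j t k)) (boxMeasure j) :=
  (integrable_comp_merge hj hf).prod_right_ae

theorem integral_integral_merge [NormedSpace ℝ E] (hj : j ≤ N) (hf : Integrable f (boxMeasure N)) :
    ∫ k, ∫ t, f (merge j t k) ∂boxMeasure j ∂boxMeasure N =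
      (2 * Real.pi) ^ j • ∫ k, f k ∂boxMeasure N := by
  have h : AEStronglyMeasurable f (Measure.map
      (fun p : (Fin N → ℝ) × (Fin j → ℝ) => merge j p.2 p.1)
      ((boxMeasure N).prod (boxMeasure j))) := by
    rw [map_merge hj]
    exact hf.1.smul_measure _
  rw [← integral_prod _ (integrable_comp_merge hj hf),
    ← integral_map continuous_merge.measurable.aemeasurable h, map_merge hj,
    integral_smul_measure, ENNReal.toReal_pow, ENNReal.toReal_ofReal (by positivity)]

theorem enorm_integral_sq_le [NormedSpace ℝ E] {Ω : Type*} [MeasurableSpace Ω] {μ : Measure Ω}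
    {g : Ω → E} (hg : AEStronglyMeasurable g μ) :
    ‖∫ x, g x ∂μ‖ₑ ^ 2 ≤ μ Set.univ * ∫⁻ x, ‖g x‖ₑ ^ 2 ∂μ := by
  have h1 : ‖∫ x, g x ∂μ‖ₑ ≤ eLpNorm g 1 μ := by
    rw [eLpNorm_one_eq_lintegral_enorm]; exact enorm_integral_le_lintegral_enorm g
  have h2 := eLpNorm_le_eLpNorm_mul_rpow_measure_univ (p := 1) (q := 2) (by norm_num) hg
  have h3 : eLpNorm g 2 μ ^ 2 = ∫⁻ x, ‖g x‖ₑ ^ 2 ∂μ := by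
    have := eLpNorm_nnreal_pow_eq_lintegral (f := g) (μ := μ) (p := 2) (by norm_num)
    simpa using this
  calc ‖∫ x, g x ∂μ‖ₑ ^ 2 ≤ (eLpNorm g 2 μ *
        μ Set.univ ^ (1 / (1 : ENNReal).toReal - 1 / (2 : ENNReal).toReal)) ^ 2 := by
        gcongr; exact h1.trans h2
    _ = _ := by
        rw [mul_pow, h3, mul_comm, ← ENNReal.rpow_natCast, ← ENNReal.rpow_mul]
        norm_num

theorem eLpNorm_integral_merge_le [NormedSpace ℝ E] (hj : j ≤ N)
    (hf : AEStronglyMeasurable f (boxMeasure N)) :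
    eLpNorm (fun k => ∫ t, f (merge j t k) ∂boxMeasure j) 2 (boxMeasure N) ≤
      ENNReal.ofReal ((2 * Real.pi) ^ j) * eLpNorm f 2 (boxMeasure N) := by
  have hsq : ∀ g : (Fin N → ℝ) → E,
      eLpNorm g 2 (boxMeasure N) ^ 2 = ∫⁻ x, ‖g x‖ₑ ^ 2 ∂boxMeasure N := fun g => by
    simpa using eLpNorm_nnreal_pow_eq_lintegral (f := g) (μ := boxMeasure N) (p := 2) (by norm_num)
  have hm : AEStronglyMeasurable (fun p : (Fin N → ℝ) × (Fin j → ℝ) => f (merge j p.2 p.1))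
      ((boxMeasure N).prod (boxMeasure j)) :=
    hf.comp_quasiMeasurePreserving (quasiMeasurePreserving_merge hj)
  have hm2 : AEMeasurable (fun p : (Fin N → ℝ) × (Fin j → ℝ) => ‖f (merge j p.2 p.1)‖ₑ ^ 2)
      ((boxMeasure N).prod (boxMeasure j)) := hm.enorm.pow_const 2
  refine (ENNReal.pow_le_pow_left_iff two_ne_zero).1 ?_
  calc eLpNorm (fun k => ∫ t, f (merge j t k) ∂boxMeasure j) 2 (boxMeasure N) ^ 2
      = ∫⁻ k, ‖∫ t, f (merge j t k) ∂boxMeasure j‖ₑ ^ 2 ∂boxMeasure N := hsq _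
    _ ≤ ∫⁻ k, ENNReal.ofReal (2 * Real.pi) ^ j *
          ∫⁻ t, ‖f (merge j t k)‖ₑ ^ 2 ∂boxMeasure j ∂boxMeasure N := by
        refine lintegral_mono_ae ?_
        filter_upwards [hm.prodMk_left] with k hk
        rw [← boxMeasure_univ]
        exact enorm_integral_sq_le hk
    _ = ENNReal.ofReal (2 * Real.pi) ^ j *
          ∫⁻ p, ‖f (merge j p.2 p.1)‖ₑ ^ 2 ∂(boxMeasure N).prod (boxMeasure j) := by
        rw [lintegral_const_mul' _ _ (ENNReal.pow_ne_top ENNReal.ofReal_ne_top),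
          lintegral_prod _ hm2]
    _ = ENNReal.ofReal (2 * Real.pi) ^ j * (ENNReal.ofReal (2 * Real.pi) ^ j *
          ∫⁻ k, ‖f k‖ₑ ^ 2 ∂boxMeasure N) := by
        rw [← smul_eq_mul (ENNReal.ofReal (2 * Real.pi) ^ j) (∫⁻ k, _ ∂boxMeasure N),
          ← lintegral_smul_measure, ← map_merge hj, lintegral_map' ?_
          continuous_merge.measurable.aemeasurable]
        rw [map_merge hj]
        exact (hf.enorm.pow_const 2).smul_measure _
    _ = (ENNReal.ofReal ((2 * Real.pi) ^ j) * eLpNorm f 2 (boxMeasure N)) ^ 2 := by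
        rw [mul_pow, hsq, ENNReal.ofReal_pow (by positivity)]
        ring

end Merge

theorem exists_clm_of_ae_linear {X E : Type*} [MeasurableSpace X] {μ : Measure X}
    [NormedAddCommGroup E] [NormedSpace ℂ E] (S : (X → E) → X → E) (C : ℝ)
    (hmeas : ∀ f : Lp E 2 μ, AEStronglyMeasurable (S f) μ)
    (hbound : ∀ f : Lp E 2 μ, eLpNorm (S f) 2 μ ≤ ENNReal.ofReal C * eLpNorm f 2 μ)
    (hcongr : ∀ f g : X → E, f =ᵐ[μ] g → S f =ᵐ[μ] S g)
    (hadd : ∀ f g : Lp E 2 μ, S (f + g) =ᵐ[μ] S f + S g)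
    (hsmul : ∀ (c : ℂ) (f : Lp E 2 μ), S (c • ⇑f) =ᵐ[μ] c • S f) :
    ∃ T : Lp E 2 μ →L[ℂ] Lp E 2 μ, ∀ f, T f =ᵐ[μ] S f := by
  have hmem : ∀ f : Lp E 2 μ, MemLp (S f) 2 μ := fun f =>
    ⟨hmeas f, (hbound f).trans_lt (ENNReal.mul_lt_top ENNReal.ofReal_lt_top (Lp.memLp f).2)⟩
  let T : Lp E 2 μ →ₗ[ℂ] Lp E 2 μ :=
    { toFun := fun f => (hmem f).toLp _
      map_add' := fun f g => by
        rw [← MemLp.toLp_add, MemLp.toLp_eq_toLp_iff]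
        exact (hcongr _ _ (Lp.coeFn_add f g)).trans (hadd f g)
      map_smul' := fun c f => by
        rw [RingHom.id_apply, ← MemLp.toLp_const_smul, MemLp.toLp_eq_toLp_iff]
        exact (hcongr _ _ (Lp.coeFn_smul c f)).trans (hsmul c f) }
  refine ⟨T.mkContinuous (max C 0) fun f => ?_, fun f => (hmem f).coeFn_toLp⟩
  change ‖(hmem f).toLp _‖ ≤ _
  rw [Lp.norm_toLp, Lp.norm_def]
  refine (ENNReal.toReal_mono (ENNReal.mul_ne_top ENNReal.ofReal_ne_top (Lp.memLp f).2.ne)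
    (hbound f)).trans_eq ?_
  rw [ENNReal.toReal_mul, ENNReal.toReal_ofReal']

section Operators

variable {N M : ℕ}

/-- Pointwise action of a matrix on `ℂ^M`, as a continuous linear map. -/
abbrev act (B : Matrix (Fin M) (Fin M) ℂ) :
    EuclideanSpace ℂ (Fin M) →L[ℂ] EuclideanSpace ℂ (Fin M) :=
  Matrix.toEuclideanCLM (𝕜 := ℂ) B

theorem continuous_act : Continuous (act (M := M)) :=
  LinearMap.continuous_of_finiteDimensional
    ((Matrix.toEuclideanCLM (𝕜 := ℂ) (n := Fin M)).toAlgEquiv.toLinearMap)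

theorem act_apply (B : Matrix (Fin M) (Fin M) ℂ) (x : EuclideanSpace ℂ (Fin M)) (a : Fin M) :
    act B x a = ∑ b, B a b * x b := by
  rw [act, Matrix.ofLp_toEuclideanCLM]
  rfl

theorem exists_act_bound {B : (Fin N → ℝ) → Matrix (Fin M) (Fin M) ℂ}
    (hB : ContinuousOn B (box N)) : ∃ C, ∀ k ∈ box N, ‖act (B k)‖ ≤ C :=
  isCompact_box.exists_bound_of_continuousOn (continuous_act.comp_continuousOn hB)

theorem aestronglyMeasurable_act {B : (Fin N → ℝ) → Matrix (Fin M) (Fin M) ℂ}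
    (hB : ContinuousOn B (box N)) {f : (Fin N → ℝ) → EuclideanSpace ℂ (Fin M)}
    (hf : AEStronglyMeasurable f (boxMeasure N)) :
    AEStronglyMeasurable (fun k => act (B k) (f k)) (boxMeasure N) :=
  (ContinuousLinearMap.id ℂ (EuclideanSpace ℂ (Fin M) →L[ℂ] EuclideanSpace ℂ (Fin M))
    ).aestronglyMeasurable_comp₂
      ((continuous_act.comp_continuousOn hB).aestronglyMeasurable measurableSet_box) hf

theorem exists_mulOp {B : (Fin N → ℝ) → Matrix (Fin M) (Fin M) ℂ}
    (hB : ContinuousOn B (box N)) :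
    ∃ T : L2M N M →L[ℂ] L2M N M, ∀ f, T f =ᵐ[boxMeasure N] fun k => act (B k) (f k) := by
  obtain ⟨C, hC⟩ := exists_act_bound hB
  refine exists_clm_of_ae_linear (fun f k => act (B k) (f k)) C
    (fun f => aestronglyMeasurable_act hB (Lp.aestronglyMeasurable f)) (fun f => ?_) ?_ ?_ ?_
  · refine eLpNorm_le_mul_eLpNorm_of_ae_le_mul ?_ 2
    filter_upwards [ae_mem_box] with k hk
    exact (act (B k)).le_of_opNorm_le (hC k hk) _
  · intro f g h
    filter_upwards [h] with k hk
    rw [hk]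
  · intro f g
    exact Filter.Eventually.of_forall fun k => by simp
  · intro c f
    exact Filter.Eventually.of_forall fun k => by simp

open Classical in
/-- Multiplication by a matrix function which is continuous on the box (`0` otherwise). -/
def mulOp (B : (Fin N → ℝ) → Matrix (Fin M) (Fin M) ℂ) : L2M N M →L[ℂ] L2M N M :=
  if h : ContinuousOn B (box N) then (exists_mulOp h).choose else 0

variable {B C : (Fin N → ℝ) → Matrix (Fin M) (Fin M) ℂ}

theorem mulOp_coe (hB : ContinuousOn B (box N)) (f : L2M N M) :
    mulOp B f =ᵐ[boxMeasure N] fun k => act (B k) (f k) := by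
  rw [mulOp, dif_pos hB]
  exact (exists_mulOp hB).choose_spec f

theorem mulOp_mul (hB : ContinuousOn B (box N)) (hC : ContinuousOn C (box N)) :
    mulOp (fun k => B k * C k) = mulOp B * mulOp C := by
  refine ContinuousLinearMap.ext fun f => Lp.ext ?_
  filter_upwards [mulOp_coe (hB.mul hC) f, mulOp_coe hB (mulOp C f), mulOp_coe hC f]
    with k h1 h2 h3
  rw [mul_apply_eq_comp, h2, h3]
  refine h1.trans ?_
  simp [act]

theorem mulOp_add_one (hB : ContinuousOn B (box N)) :
    mulOp (fun k => 1 + B k) = 1 + mulOp B := by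
  refine ContinuousLinearMap.ext fun f => Lp.ext ?_
  filter_upwards [mulOp_coe (continuousOn_const.add hB) f, mulOp_coe hB f,
    Lp.coeFn_add f (mulOp B f)] with k h1 h2 h3
  rw [add_apply, one_apply_eq_self, h3, Pi.add_apply, h2]
  refine h1.trans ?_
  simp [act]

theorem mulOp_eq_one (h : ∀ k ∈ box N, B k = 1) : mulOp B = 1 := by
  have hB : ContinuousOn B (box N) := continuousOn_const.congr h
  refine ContinuousLinearMap.ext fun f => Lp.ext ?_
  filter_upwards [mulOp_coe hB f, ae_mem_box] with k h1 hk
  rw [h1, h k hk]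
  simp [act]

theorem continuousOn_matrix_inv (hB : ContinuousOn B (box N))
    (hdet : ∀ k ∈ box N, (B k).det ≠ 0) : ContinuousOn (fun k => (B k)⁻¹) (box N) := by
  simp only [Matrix.inv_def, Ring.inverse_eq_inv']
  exact ((Continuous.matrix_det continuous_id).comp_continuousOn hB |>.inv₀ hdet).smul
    ((Continuous.matrix_adjugate continuous_id).comp_continuousOn hB)

theorem mulOp_mul_inv (hB : ContinuousOn B (box N)) (hdet : ∀ k ∈ box N, (B k).det ≠ 0) :
    mulOp B * mulOp (fun k => (B k)⁻¹) = 1 := by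
  rw [← mulOp_mul hB (continuousOn_matrix_inv hB hdet)]
  exact mulOp_eq_one fun k hk => Matrix.mul_nonsing_inv _ (isUnit_iff_ne_zero.2 (hdet k hk))

theorem mulOp_inv_mul (hB : ContinuousOn B (box N)) (hdet : ∀ k ∈ box N, (B k).det ≠ 0) :
    mulOp (fun k => (B k)⁻¹) * mulOp B = 1 := by
  rw [← mulOp_mul (continuousOn_matrix_inv hB hdet) hB]
  exact mulOp_eq_one fun k hk => Matrix.nonsing_inv_mul _ (isUnit_iff_ne_zero.2 (hdet k hk))

/-- The normalizing factor of `⟨·⟩_{1…j}`. -/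
abbrev navgScale (j : ℕ) : ℝ := ((2 * Real.pi) ^ ((j : ℝ) / 2))⁻¹

theorem navgScale_pos (j : ℕ) : 0 < navgScale j := by
  have := Real.pi_pos
  unfold navgScale
  positivity

theorem navg_eq (j : ℕ) (f : (Fin N → ℝ) → EuclideanSpace ℂ (Fin M)) (k : Fin N → ℝ) :
    navg j f k = navgScale j • ∫ t, f (merge j t k) ∂boxMeasure j := rfl

variable {j : ℕ}

theorem navg_congr (hj : j ≤ N) {f g : (Fin N → ℝ) → EuclideanSpace ℂ (Fin M)}
    (h : f =ᵐ[boxMeasure N] g) : navg j f =ᵐ[boxMeasure N] navg j g := by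
  filter_upwards [ae_ae_merge hj h] with k hk
  rw [navg_eq, navg_eq, integral_congr_ae hk]

theorem Lp_integrable (f : L2M N M) : Integrable f (boxMeasure N) :=
  (Lp.memLp f).integrable (by norm_num)

theorem exists_navgOp (hj : j ≤ N) :
    ∃ T : L2M N M →L[ℂ] L2M N M, ∀ f, T f =ᵐ[boxMeasure N] navg j f := by
  have hmeas : ∀ f : L2M N M, AEStronglyMeasurable
      (fun k => ∫ t, f (merge j t k) ∂boxMeasure j) (boxMeasure N) := fun f =>
    ((Lp.aestronglyMeasurable f).comp_quasiMeasurePreserving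
      (quasiMeasurePreserving_merge hj)).integral_prod_right'
  refine exists_clm_of_ae_linear (fun f => navg j f) (navgScale j * (2 * Real.pi) ^ j)
    (fun f => (hmeas f).const_smul (navgScale j)) (fun f => ?_) (fun f g => navg_congr hj) ?_ ?_
  · have h1 := eLpNorm_const_smul_le (p := 2) (μ := boxMeasure N) (c := navgScale j)
      (f := fun k => ∫ t, f (merge j t k) ∂boxMeasure j)
    refine h1.trans ?_
    rw [ENNReal.ofReal_mul (navgScale_pos j).le, mul_assoc,
      Real.enorm_of_nonneg (navgScale_pos j).le]
    gcongr
    exact eLpNorm_integral_merge_le hj (Lp.aestronglyMeasurable f)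
  · intro f g
    filter_upwards [ae_integrable_merge hj (Lp_integrable f),
      ae_integrable_merge hj (Lp_integrable g)] with k h1 h2
    simp only [navg_eq, Pi.add_apply]
    rw [integral_add h1 h2, smul_add]
  · intro c f
    filter_upwards with k
    simp only [navg_eq, Pi.smul_apply]
    rw [integral_smul, smul_comm]

open Classical in
/-- The operator `⟨·⟩_{1…j}` on `L²_M` (`0` if `N < j`). -/
def navgOp (j : ℕ) : L2M N M →L[ℂ] L2M N M :=
  if h : j ≤ N then (exists_navgOp h).choose else 0

theorem navgOp_coe (hj : j ≤ N) (f : L2M N M) : navgOp j f =ᵐ[boxMeasure N] navg j f := by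
  rw [navgOp, dif_pos hj]
  exact (exists_navgOp hj).choose_spec f

theorem navg_merge (f : (Fin N → ℝ) → EuclideanSpace ℂ (Fin M)) (t : Fin j → ℝ)
    (k : Fin N → ℝ) : navg j f (merge j t k) = navg j f k := by
  simp only [navg_eq]
  congr 2
  ext1 s
  rw [merge_congr s fun i hi => merge_apply_of_le t k hi]

theorem navgOp_eq_smul_mul {i : ℕ} (hji : j ≤ i) (hi : i ≤ N) :
    ∃ c : ℂ, (navgOp i : L2M N M →L[ℂ] L2M N M) = c • (navgOp i * navgOp j) := by
  have hpi := Real.pi_pos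
  refine ⟨((navgScale j * (2 * Real.pi) ^ j)⁻¹ : ℝ), ContinuousLinearMap.ext fun f => Lp.ext ?_⟩
  have hj := hji.trans hi
  rw [smul_apply, mul_apply_eq_comp]
  filter_upwards [navgOp_coe hi f, navgOp_coe hi (navgOp j f),
    Lp.coeFn_smul (((navgScale j * (2 * Real.pi) ^ j)⁻¹ : ℝ) : ℂ) (navgOp i (navgOp j f)),
    navg_congr hi (navgOp_coe hj f), ae_integrable_merge hi (Lp_integrable f)] with k h1 h2 h3 h4 h5
  rw [h1, h3, Pi.smul_apply, h2, h4, Complex.coe_smul]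
  have key : navg i (navg j f) k = (navgScale j * (2 * Real.pi) ^ j) • navg i f k := by
    simp only [navg_eq]
    simp only [merge_merge hji]
    rw [integral_smul, integral_integral_merge hji h5, smul_smul, smul_smul, smul_smul]
    congr 1
    ring
  have hne : navgScale j * (2 * Real.pi) ^ j ≠ 0 := by
    have := navgScale_pos j
    positivity
  rw [key, smul_smul, inv_mul_cancel₀ hne, one_smul]

theorem navgOp_mulOp_comm (hj : j ≤ N) (hB : ContinuousOn B (box N))
    (hind : ∀ t k, B (merge j t k) = B k) :
    (navgOp j : L2M N M →L[ℂ] L2M N M) * mulOp B = mulOp B * navgOp j := by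
  refine ContinuousLinearMap.ext fun f => Lp.ext ?_
  rw [mul_apply_eq_comp, mul_apply_eq_comp]
  filter_upwards [navgOp_coe hj (mulOp B f), mulOp_coe hB (navgOp j f), navgOp_coe hj f,
    navg_congr hj (mulOp_coe hB f), ae_integrable_merge hj (Lp_integrable f)] with k h1 h2 h3 h4 h5
  rw [h1, h2, h3, h4, navg_eq, navg_eq]
  simp only [hind]
  rw [ContinuousLinearMap.integral_comp_comm _ h5, ContinuousLinearMap.map_smul_of_tower]

/-- The entrywise normalized average `⟨C⟩_{1…j}` of a matrix function. -/
def matAvg (j : ℕ) (C : (Fin N → ℝ) → Matrix (Fin M) (Fin M) ℂ) (k : Fin N → ℝ) :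
    Matrix (Fin M) (Fin M) ℂ :=
  Matrix.of fun a b => (navgScale j : ℂ) * ∫ t, C (merge j t k) a b ∂boxMeasure j

theorem matAvg_merge (t : Fin j → ℝ) (k : Fin N → ℝ) :
    matAvg j C (merge j t k) = matAvg j C k := by
  unfold matAvg
  congr 1
  funext a b
  congr 2
  ext1 s
  rw [merge_congr s fun i hi => merge_apply_of_le t k hi]

theorem continuousOn_comp_merge (hC : ContinuousOn C (box N)) {k : Fin N → ℝ} (hk : k ∈ box N) :
    ContinuousOn (fun t => C (merge j t k)) (box j) :=
  hC.comp (continuous_merge.comp (Continuous.prodMk_right k)).continuousOn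
    fun _ ht => merge_mem_box ht hk

theorem continuousOn_matAvg (hC : ContinuousOn C (box N)) : ContinuousOn (matAvg j C) (box N) := by
  refine continuousOn_pi.2 fun a => continuousOn_pi.2 fun b => ?_
  have hCab : ContinuousOn (fun k => C k a b) (box N) :=
    continuousOn_pi.1 (continuousOn_pi.1 hC a) b
  obtain ⟨K, hK⟩ := isCompact_box.exists_bound_of_continuousOn hCab
  refine continuousOn_const.mul (continuousOn_of_dominated (bound := fun _ => K) ?_ ?_
    (integrable_const _) ?_)
  · intro k hk
    exact (continuousOn_pi.1 (continuousOn_pi.1 (continuousOn_comp_merge hC hk) a)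
      b).aestronglyMeasurable measurableSet_box
  · intro k hk
    filter_upwards [ae_mem_box] with t ht
    exact hK _ (merge_mem_box ht hk)
  · filter_upwards [ae_mem_box] with t ht
    exact hCab.comp (continuous_merge.comp (Continuous.prodMk_left t)).continuousOn
      fun _ hk => merge_mem_box ht hk

theorem integral_act (hC : ContinuousOn C (box N)) {k : Fin N → ℝ} (hk : k ∈ box N)
    (x : EuclideanSpace ℂ (Fin M)) :
    navgScale j • ∫ t, act (C (merge j t k)) x ∂boxMeasure j = act (matAvg j C k) x := by
  have hcont := continuousOn_comp_merge (j := j) hC hk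
  have hint : Integrable (fun t => act (C (merge j t k)) x) (boxMeasure j) :=
    ((continuous_act.comp_continuousOn hcont).clm_apply continuousOn_const).integrableOn_compact
      isCompact_box
  have hint' : ∀ a b, Integrable (fun t => C (merge j t k) a b) (boxMeasure j) := fun a b =>
    (continuousOn_pi.1 (continuousOn_pi.1 hcont a) b).integrableOn_compact isCompact_box
  ext a
  have h1 : (∫ t, act (C (merge j t k)) x ∂boxMeasure j) a =
      ∫ t, act (C (merge j t k)) x a ∂boxMeasure j :=
    ((EuclideanSpace.proj (𝕜 := ℂ) a).integral_comp_comm hint).symm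
  rw [PiLp.smul_apply, h1, act_apply]
  simp only [act_apply]
  rw [integral_finsetSum _ fun b _ => (hint' a b).mul_const _, Finset.smul_sum]
  refine Finset.sum_congr rfl fun b _ => ?_
  rw [integral_mul_const, matAvg, Matrix.of_apply, Complex.real_smul]
  ring

theorem navgOp_mulOp_navgOp (hj : j ≤ N) (hC : ContinuousOn C (box N)) :
    (navgOp j : L2M N M →L[ℂ] L2M N M) * mulOp C * navgOp j = mulOp (matAvg j C) * navgOp j := by
  refine ContinuousLinearMap.ext fun f => Lp.ext ?_
  simp only [mul_apply_eq_comp]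
  have h0 : mulOp C (navgOp j f) =ᵐ[boxMeasure N] fun k => act (C k) (navg j f k) := by
    filter_upwards [mulOp_coe hC (navgOp j f), navgOp_coe hj f] with k h1 h2
    rw [h1, h2]
  filter_upwards [navgOp_coe hj (mulOp C (navgOp j f)), navg_congr hj h0,
    mulOp_coe (continuousOn_matAvg (j := j) hC) (navgOp j f), navgOp_coe hj f, ae_mem_box]
    with k h1 h2 h3 h4 hk
  rw [h1, h2, h3, h4, ← integral_act hC hk, navg_eq]
  simp only [navg_merge]

end Operators

/-- If `D` is invertible and `P D⁻¹ = P q`, then `D + a P` is invertible as soon as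
`b = 1 + P q a` on the range of `P` is, and its inverse is compressed by `P` to `b⁻¹ q`. -/
theorem exists_inverse_add_mul {R : Type*} [Ring R] {D E a P b b' q : R}
    (hDE : D * E = 1) (hED : E * D = 1) (hbb' : b * b' = 1) (hb'b : b' * b = 1)
    (hPb : P * b = b * P) (hPE : P * E = P * q) (hPq : P * (q * a) * P = (b - 1) * P) :
    ∃ X, (D + a * P) * X = 1 ∧ X * (D + a * P) = 1 ∧ P * X = P * (b' * q) := by
  have hPb' : P * b' = b' * P := by
    calc P * b' = b' * b * P * b' := by rw [hb'b, one_mul]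
      _ = b' * (b * P) * b' := by noncomm_ring
      _ = b' * P * (b * b') := by rw [← hPb]; noncomm_ring
      _ = b' * P := by rw [hbb', mul_one]
  have hPEaP : P * E * a * P = (b - 1) * P := by rw [hPE, ← hPq]; noncomm_ring
  have hmid : P * E * a * b' * P = P - b' * P := by
    calc P * E * a * b' * P = P * E * a * (b' * P) := by noncomm_ring
      _ = P * E * a * P * b' := by rw [← hPb']; noncomm_ring
      _ = (b - 1) * (P * b') := by rw [hPEaP]; noncomm_ring
      _ = b * b' * P - b' * P := by rw [hPb']; noncomm_ring
      _ = P - b' * P := by rw [hbb', one_mul]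
  refine ⟨E - E * a * b' * P * E, ?_, ?_, ?_⟩
  · calc (D + a * P) * (E - E * a * b' * P * E)
        = D * E - (D * E) * a * b' * P * E + a * P * E - a * (P * E * a * b' * P) * E := by
          noncomm_ring
      _ = 1 := by rw [hmid, hDE]; noncomm_ring
  · calc (E - E * a * b' * P * E) * (D + a * P)
        = E * D + E * a * P - E * a * b' * P * (E * D) - E * a * b' * (P * E * a * P) := by
          noncomm_ring
      _ = 1 + E * a * P - E * a * b' * P - E * a * (b' * b) * P + E * a * b' * P := by
          rw [hPEaP, hED]; noncomm_ring
      _ = 1 := by rw [hb'b]; noncomm_ring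
  · calc P * (E - E * a * b' * P * E) = P * E - (P * E * a * b' * P) * E := by noncomm_ring
      _ = b' * (P * E) := by rw [hmid]; noncomm_ring
      _ = (b' * P) * q := by rw [hPE]; noncomm_ring
      _ = P * (b' * q) := by rw [← hPb']; noncomm_ring

section Recursion

variable {N M : ℕ} {A : (Fin N → ℝ) → Matrix (Fin M) (Fin M) ℂ}
  {AA : ℕ → (Fin N → ℝ) → Matrix (Fin M) (Fin M) ℂ} {lam : ℂ} {j : ℕ}

theorem Bseq_succ_fst (j : ℕ) : (Bseq A AA lam (j + 1)).1 = fun k => 1 +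
    matAvg (j + 1) (fun k => ((Bseq A AA lam j).1 k)⁻¹ * (Bseq A AA lam j).2 k * AA (j + 1) k)
      k := by
  funext k
  rw [Bseq]
  simp only [matAvg, navgScale, boxMeasure, box]
  push_cast
  rfl

theorem Bseq_succ_snd (j : ℕ) :
    (Bseq A AA lam (j + 1)).2 = fun k => ((Bseq A AA lam j).1 k)⁻¹ * (Bseq A AA lam j).2 k := by
  rw [Bseq]

theorem Bseq_fst_merge (t : Fin j → ℝ) (k : Fin N → ℝ) :
    (Bseq A AA lam j).1 (merge j t k) = (Bseq A AA lam j).1 k := by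
  cases j with
  | zero =>
    congr 1
  | succ j => simp only [Bseq_succ_fst, matAvg_merge]

theorem continuousOn_Bseq (hA : Continuous A) (hAA : ∀ j ∈ Finset.Icc 1 N, Continuous (AA j))
    (hj : j ≤ N) (hdet : ∀ i < j, ∀ k ∈ box N, ((Bseq A AA lam i).1 k).det ≠ 0) :
    ContinuousOn (Bseq A AA lam j).1 (box N) ∧ ContinuousOn (Bseq A AA lam j).2 (box N) := by
  induction j with
  | zero =>
    simp only [Bseq]
    exact ⟨(hA.sub continuous_const).continuousOn, continuousOn_const⟩
  | succ j ih =>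
    obtain ⟨h1, h2⟩ := ih (by omega) fun i hi => hdet i (by omega)
    have h3 := (continuousOn_matrix_inv h1 (hdet j (by omega))).mul h2
    refine ⟨?_, by rw [Bseq_succ_snd]; exact h3⟩
    rw [Bseq_succ_fst]
    exact continuousOn_const.add (continuousOn_matAvg
      (h3.mul (hAA (j + 1) (Finset.mem_Icc.2 ⟨by omega, hj⟩)).continuousOn))

/-- The partial sums `(A - λ) + ∑_{i ≤ j} A_i ⟨·⟩_{1…i}` of `Ĉ - λ`. -/
def partialOp (A : (Fin N → ℝ) → Matrix (Fin M) (Fin M) ℂ)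
    (AA : ℕ → (Fin N → ℝ) → Matrix (Fin M) (Fin M) ℂ) (lam : ℂ) :
    ℕ → (L2M N M →L[ℂ] L2M N M)
  | 0 => mulOp (Bseq A AA lam 0).1
  | j + 1 => partialOp A AA lam j + mulOp (AA (j + 1)) * navgOp (j + 1)

theorem navgOp_mul_Bseq_mul_navgOp (hA : Continuous A)
    (hAA : ∀ j ∈ Finset.Icc 1 N, Continuous (AA j)) (hj : j + 1 ≤ N)
    (hdet : ∀ i ≤ j, ∀ k ∈ box N, ((Bseq A AA lam i).1 k).det ≠ 0) :
    navgOp (j + 1) * (mulOp (Bseq A AA lam (j + 1)).2 * mulOp (AA (j + 1))) * navgOp (j + 1) =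
      (mulOp (Bseq A AA lam (j + 1)).1 - 1) * navgOp (j + 1) := by
  have hc := (continuousOn_Bseq hA hAA hj fun i hi => hdet i (by omega)).2
  have hAj := (hAA (j + 1) (Finset.mem_Icc.2 ⟨by omega, hj⟩)).continuousOn (s := box N)
  have hm : ContinuousOn (fun k => (Bseq A AA lam (j + 1)).2 k * AA (j + 1) k) (box N) :=
    hc.mul hAj
  rw [← mulOp_mul hc hAj, navgOp_mulOp_navgOp hj hm, Bseq_succ_fst, mulOp_add_one,
    add_sub_cancel_left, Bseq_succ_snd]
  rw [Bseq_succ_snd] at hm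
  exact continuousOn_matAvg hm

theorem exists_inverse_partialOp (hA : Continuous A)
    (hAA : ∀ j ∈ Finset.Icc 1 N, Continuous (AA j)) (hj : j ≤ N)
    (hdet : ∀ i ≤ j, ∀ k ∈ box N, ((Bseq A AA lam i).1 k).det ≠ 0) :
    ∃ E, partialOp A AA lam j * E = 1 ∧ E * partialOp A AA lam j = 1 ∧
      navgOp j * E = navgOp j * mulOp (Bseq A AA lam (j + 1)).2 := by
  induction j with
  | zero =>
    have hc := (continuousOn_Bseq (lam := lam) hA hAA hj (by simp)).1
    refine ⟨_, mulOp_mul_inv hc (hdet 0 le_rfl), mulOp_inv_mul hc (hdet 0 le_rfl), ?_⟩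
    rw [Bseq_succ_snd]
    simp [Bseq]
  | succ j ih =>
    have hdet' : ∀ i ≤ j, ∀ k ∈ box N, ((Bseq A AA lam i).1 k).det ≠ 0 :=
      fun i hi => hdet i (by omega)
    obtain ⟨E, hDE, hED, hPE⟩ := ih (by omega) hdet'
    obtain ⟨hc1, hc2⟩ := continuousOn_Bseq (lam := lam) hA hAA hj fun i hi => hdet i (by omega)
    have hd := hdet (j + 1) le_rfl
    obtain ⟨c, hc⟩ := navgOp_eq_smul_mul (M := M) (Nat.le_succ j) hj
    have hPE' : navgOp (j + 1) * E = navgOp (j + 1) * mulOp (Bseq A AA lam (j + 1)).2 := by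
      rw [hc, smul_mul_assoc, mul_assoc, hPE, smul_mul_assoc, mul_assoc]
    rw [Bseq_succ_snd (j + 1), mulOp_mul (continuousOn_matrix_inv hc1 hd) hc2]
    exact exists_inverse_add_mul hDE hED (mulOp_mul_inv hc1 hd) (mulOp_inv_mul hc1 hd)
      (navgOp_mulOp_comm hj hc1 Bseq_fst_merge) hPE'
      (navgOp_mul_Bseq_mul_navgOp hA hAA hj hdet')

theorem partialOp_eq_add_mul_navgOp {n : ℕ} (hjn : j ≤ n) (hn : n ≤ N) :
    ∃ W : L2M N M →L[ℂ] L2M N M, partialOp A AA lam n = partialOp A AA lam j + W * navgOp j ∧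
      ∀ g, (∀ i, j < i → i ≤ n → navgOp i g = 0) → W g = 0 := by
  induction n, hjn using Nat.le_induction with
  | base => exact ⟨0, by simp, by simp⟩
  | succ n hjn ih =>
    obtain ⟨W, h1, h2⟩ := ih (by omega)
    obtain ⟨c, hc⟩ := navgOp_eq_smul_mul (M := M) (hjn.trans (Nat.le_succ n)) hn
    refine ⟨W + c • (mulOp (AA (n + 1)) * navgOp (n + 1)), ?_, fun g hg => ?_⟩
    · rw [partialOp, h1, add_mul, smul_mul_assoc, mul_assoc, ← mul_smul_comm, ← hc, add_assoc]
    · rw [add_apply, smul_apply, mul_apply_eq_comp, hg (n + 1) (by omega) le_rfl,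
        h2 g fun i hi hi' => hg i hi (by omega)]
      simp

theorem exists_left_inverse_on_eigen (hA : Continuous A)
    (hAA : ∀ j ∈ Finset.Icc 1 N, Continuous (AA j)) (hj : j ≤ N)
    (hdet : ∀ i < j, ∀ k ∈ box N, ((Bseq A AA lam i).1 k).det ≠ 0)
    (hunit : IsUnit (partialOp A AA lam N)) :
    ∃ L : L2M N M →L[ℂ] L2M N M, ∀ g, (∃ κ : ℂ, κ ≠ 0 ∧ navgOp j g = κ • g) →
      (∀ i, j < i → i ≤ N → navgOp i g = 0) → g = L (mulOp (Bseq A AA lam j).1 g) := by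
  obtain ⟨W, hW, hWg⟩ := partialOp_eq_add_mul_navgOp (A := A) (AA := AA) (lam := lam) hj le_rfl
  obtain ⟨Z, hZ, hZ'⟩ : ∃ Z, partialOp A AA lam N * Z = 1 ∧ Z * partialOp A AA lam N = 1 :=
    isUnit_iff_exists.1 hunit
  cases j with
  | zero =>
    refine ⟨Z, fun g ⟨κ, hκ, hg⟩ hgi => ?_⟩
    have : partialOp A AA lam N g = mulOp (Bseq A AA lam 0).1 g := by
      rw [hW, add_apply, mul_apply_eq_comp, hg, map_smul, hWg g hgi, smul_zero, add_zero]
      rfl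
    rw [← this, ← mul_apply_eq_comp, hZ', one_apply_eq_self]
  | succ j =>
    obtain ⟨E, hDE, hED, hPE⟩ := exists_inverse_partialOp (lam := lam) (j := j) hA hAA (by omega)
      fun i hi => hdet i (by omega)
    obtain ⟨c, hc⟩ := navgOp_eq_smul_mul (M := M) (Nat.le_succ j) hj
    have hPE' : navgOp (j + 1) * E = navgOp (j + 1) * mulOp (Bseq A AA lam (j + 1)).2 := by
      rw [hc, smul_mul_assoc, mul_assoc, hPE, smul_mul_assoc, mul_assoc]
    set P : L2M N M →L[ℂ] L2M N M := navgOp (j + 1) with hP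
    set b := mulOp (Bseq A AA lam (j + 1)).1 with hb
    set a := mulOp (AA (j + 1)) with ha
    refine ⟨1 - P * Z * (a + W), fun g ⟨κ, hκ, hg⟩ hgi => ?_⟩
    have hPf : P (E (a g)) = b g - g := by
      have h := congrArg (fun T => T g) (navgOp_mul_Bseq_mul_navgOp (lam := lam) hA hAA hj
        fun i hi => hdet i (by omega))
      rw [← mul_assoc, ← hPE'] at h
      simp only [mul_apply_eq_comp, sub_apply, one_apply_eq_self, ← hP, ← ha, ← hb, hg,
        map_smul] at h
      exact smul_right_injective _ hκ h
    have hDf : partialOp A AA lam N (E (a g)) = (a + W) (b g) := by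
      have h1 : partialOp A AA lam j (E (a g)) = a g := by
        rw [← mul_apply_eq_comp, hDE, one_apply_eq_self]
      rw [hW, partialOp, ← ha, ← hP]
      simp only [add_apply, mul_apply_eq_comp, h1, hPf, map_sub, hWg g hgi]
      abel
    have hf : E (a g) = Z ((a + W) (b g)) := by
      rw [← hDf, ← mul_apply_eq_comp Z, hZ', one_apply_eq_self]
    rw [sub_apply, mul_apply_eq_comp, mul_apply_eq_comp, ← hf, hPf, one_apply_eq_self]
    abel

end Recursion

theorem exists_localized_meanZero {x₀ δ : ℝ} (hx₀ : x₀ ∈ Set.Icc (-Real.pi) Real.pi)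
    (hδ : 0 < δ) :
    ∃ φ : ℝ → ℝ, Measurable φ ∧ (∀ x, |φ x| ≤ 2 * Real.pi) ∧ (∀ x, φ x ≠ 0 → |x - x₀| < δ) ∧
      ∫ x in Set.Icc (-Real.pi) Real.pi, φ x = 0 ∧
      0 < ∫ x in Set.Icc (-Real.pi) Real.pi, φ x ^ 2 := by
  have hpi := Real.pi_pos
  obtain ⟨a, b, hab, ha, hb, ha', hb'⟩ : ∃ a b : ℝ, a < b ∧ -Real.pi ≤ a ∧ b ≤ Real.pi ∧
      x₀ - δ < a ∧ b < x₀ + δ := by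
    refine ⟨max (-Real.pi) (x₀ - δ / 2), min Real.pi (x₀ + δ / 2), ?_, le_max_left _ _,
      min_le_left _ _, lt_max_of_lt_right (by linarith), min_lt_of_right_lt (by linarith)⟩
    rw [max_lt_iff, lt_min_iff, lt_min_iff]
    exact ⟨⟨by linarith, by linarith [hx₀.1]⟩, by linarith [hx₀.2], by linarith⟩
  have hsub : Set.Icc (-Real.pi) Real.pi ∩ Set.Icc a b = Set.Icc a b :=
    Set.inter_eq_right.2 (Set.Icc_subset_Icc ha hb)
  refine ⟨(Set.Icc a b).indicator fun x => x - (a + b) / 2,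
    (measurable_id.sub_const _).indicator measurableSet_Icc, fun x => ?_, fun x hx => ?_, ?_, ?_⟩
  · by_cases hx : x ∈ Set.Icc a b
    · rw [Set.indicator_of_mem hx, abs_le]
      constructor <;> linarith [hx.1, hx.2]
    · rw [Set.indicator_of_notMem hx, abs_zero]
      positivity
  · have hx' := Set.mem_of_indicator_ne_zero hx
    rw [abs_lt]
    constructor <;> linarith [hx'.1, hx'.2]
  · rw [setIntegral_indicator measurableSet_Icc, hsub, integral_Icc_eq_integral_Ioc,
      ← intervalIntegral.integral_of_le hab.le, intervalIntegral.integral_sub (by simp) (by simp)]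
    simp
    ring
  · have : ∀ x, (Set.Icc a b).indicator (fun x => x - (a + b) / 2) x ^ 2 =
        (Set.Icc a b).indicator (fun x => (x - (a + b) / 2) ^ 2) x := fun x => by
      by_cases hx : x ∈ Set.Icc a b <;> simp [hx]
    simp only [this]
    rw [setIntegral_indicator measurableSet_Icc, hsub, integral_Icc_eq_integral_Ioc,
      ← intervalIntegral.integral_of_le hab.le,
      intervalIntegral.integral_comp_sub_right (fun x => x ^ 2), integral_pow]
    have h1 : a - (a + b) / 2 = -((b - a) / 2) := by ring
    have h2 : b - (a + b) / 2 = (b - a) / 2 := by ring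
    have h3 : 0 < ((b - a) / 2) ^ 3 := pow_pos (by linarith) 3
    rw [h1, h2]
    norm_num
    linarith

section LocalizedModes

variable {N M j : ℕ}

theorem exists_prod_merge_eq {i : ℕ} (hi : i ≤ N) (ψ : Fin N → ℝ → ℝ) (k : Fin N → ℝ) :
    ∃ c, ∀ t : Fin i → ℝ,
      ∏ l, ψ l (merge i t k l) = (∏ l : Fin i, ψ (Fin.castLE hi l) (t l)) * c := by
  obtain ⟨n, rfl⟩ := Nat.exists_eq_add_of_le hi
  refine ⟨∏ l : Fin n, ψ (Fin.natAdd i l) (k (Fin.natAdd i l)), fun t => ?_⟩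
  rw [Fin.prod_univ_add]
  congr 1
  · refine Finset.prod_congr rfl fun l _ => ?_
    simp [merge]
    rfl
  · refine Finset.prod_congr rfl fun l _ => ?_
    simp [merge]

theorem integral_prod_merge_eq_zero {i : ℕ} (hi : i ≤ N) (ψ : Fin N → ℝ → ℝ) (k : Fin N → ℝ)
    {l : Fin N} (hl : (l : ℕ) < i) (h0 : ∫ x in Set.Icc (-Real.pi) Real.pi, ψ l x = 0) :
    ∫ t, ∏ m, ψ m (merge i t k m) ∂boxMeasure i = 0 := by
  obtain ⟨c, hc⟩ := exists_prod_merge_eq hi ψ k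
  simp only [hc]
  rw [integral_mul_const, boxMeasure_eq_pi,
    integral_fintype_prod_eq_prod fun m : Fin i => ψ (Fin.castLE hi m),
    Finset.prod_eq_zero (Finset.mem_univ (⟨l, hl⟩ : Fin i)) h0, zero_mul]

theorem exists_localized_mode (hj : j ≤ N) {B : (Fin N → ℝ) → Matrix (Fin M) (Fin M) ℂ}
    (hB : ContinuousOn B (box N)) (hind : ∀ (t : Fin j → ℝ) k, B (merge j t k) = B k)
    {k₀ : Fin N → ℝ} (hk₀ : k₀ ∈ box N) (hdet : (B k₀).det = 0) {ε : ℝ} (hε : 0 < ε) :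
    ∃ g : L2M N M, g ≠ 0 ∧ ‖mulOp B g‖ ≤ ε * ‖g‖ ∧ (∃ κ : ℂ, κ ≠ 0 ∧ navgOp j g = κ • g) ∧
      ∀ i, j < i → i ≤ N → navgOp i g = 0 := by
  have hpi := Real.pi_pos
  obtain ⟨v', hv'0, hv'⟩ := Matrix.exists_mulVec_eq_zero_iff.2 hdet
  set v : EuclideanSpace ℂ (Fin M) := WithLp.toLp 2 v' with hvdef
  have hv0 : v ≠ 0 := fun h => hv'0 (by simpa [hvdef] using h)
  have hv : act (B k₀) v = 0 := by rw [hvdef, act, Matrix.toEuclideanCLM_toLp, hv']; rfl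
  obtain ⟨δ, hδ, hδB⟩ : ∃ δ > 0, ∀ k ∈ box N, dist k k₀ < δ → ‖act (B k) v‖ ≤ ε * ‖v‖ := by
    have hc : ContinuousOn (fun k => ‖act (B k) v‖) (box N) :=
      ((continuous_act.comp_continuousOn hB).clm_apply continuousOn_const).norm
    have hpos : ‖act (B k₀) v‖ < ε * ‖v‖ := by
      rw [hv, norm_zero]
      exact mul_pos hε (norm_pos_iff.2 hv0)
    obtain ⟨δ, hδ, h⟩ := Metric.mem_nhdsWithin_iff.1 ((hc k₀ hk₀).eventually (Iio_mem_nhds hpos))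
    exact ⟨δ, hδ, fun k hk hd => (h ⟨hd, hk⟩).le⟩
  choose φ hφm hφb hφs hφ0 hφ2 using fun i : Fin N =>
    exists_localized_meanZero (hk₀ i trivial) hδ
  set ψ : Fin N → ℝ → ℝ := fun i => if (i : ℕ) < j then fun _ => 1 else φ i with hψ
  have hψlt : ∀ i : Fin N, (i : ℕ) < j → ψ i = fun _ => 1 := fun i hi => by simp [hψ, hi]
  have hψge : ∀ i : Fin N, j ≤ (i : ℕ) → ψ i = φ i := fun i hi => by simp [hψ, not_lt.2 hi]
  set s : (Fin N → ℝ) → ℝ := fun k => ∏ i, ψ i (k i) with hs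
  have hψm : ∀ i, Measurable (ψ i) := fun i => by
    rcases lt_or_ge (i : ℕ) j with hi | hi
    · rw [hψlt i hi]; exact measurable_const
    · rw [hψge i hi]; exact hφm i
  have hsm : Measurable s :=
    Finset.measurable_prod _ fun i _ => (hψm i).comp (measurable_pi_apply i)
  have hsb : ∀ k, |s k| ≤ (2 * Real.pi) ^ N := fun k => by
    rw [hs, Finset.abs_prod]
    refine (Finset.prod_le_prod (fun _ _ => abs_nonneg _) (g := fun _ => 2 * Real.pi)
      fun i _ => ?_).trans_eq (by simp)
    rcases lt_or_ge (i : ℕ) j with hi | hi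
    · rw [hψlt i hi, abs_one]; linarith [Real.pi_gt_three]
    · rw [hψge i hi]; exact hφb i _
  have hs2 : 0 < ∫ k, s k ^ 2 ∂boxMeasure N := by
    simp only [hs, ← Finset.prod_pow]
    rw [boxMeasure_eq_pi, integral_fintype_prod_eq_prod fun i : Fin N => fun x => ψ i x ^ 2]
    refine Finset.prod_pos fun i _ => ?_
    rcases lt_or_ge (i : ℕ) j with hi | hi
    · rw [hψlt i hi]; simp [Measure.real, ENNReal.toReal_ofReal (add_pos hpi hpi).le, hpi]
    · rw [hψge i hi]; exact hφ2 i
  have hmem : MemLp (fun k => s k • v) 2 (boxMeasure N) :=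
    MemLp.of_bound (hsm.aestronglyMeasurable.smul_const v) ((2 * Real.pi) ^ N * ‖v‖)
      (Filter.Eventually.of_forall fun k => by
        rw [norm_smul, Real.norm_eq_abs]; gcongr; exact hsb k)
  have hg := hmem.coeFn_toLp
  refine ⟨hmem.toLp _, fun h0 => ?_, ?_, ?_, ?_⟩
  · rw [h0] at hg
    refine hs2.ne' (integral_eq_zero_of_ae ?_)
    filter_upwards [hg, Lp.coeFn_zero (EuclideanSpace ℂ (Fin M)) 2 (boxMeasure N)] with k h1 h2
    rw [h2, Pi.zero_apply, eq_comm, smul_eq_zero, or_iff_left hv0] at h1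
    simp [h1]
  · refine Lp.norm_le_mul_norm_of_ae_le_mul ?_
    filter_upwards [mulOp_coe hB (hmem.toLp _), hg, ae_mem_box] with k h1 h2 hk
    rw [h1, h2, ContinuousLinearMap.map_smul_of_tower, norm_smul, norm_smul, mul_left_comm]
    by_cases hsk : s k = 0
    · simp [hsk]
    gcongr
    rw [← hind (fun i => k₀ (Fin.castLE hj i)) k]
    refine hδB _ (merge_mem_box (fun i _ => hk₀ _ trivial) hk) ?_
    rw [dist_pi_lt_iff hδ]
    intro i
    rcases lt_or_ge (i : ℕ) j with hi | hi
    · simp only [merge, hi, dite_true]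
      rw [show Fin.castLE hj ⟨(i : ℕ), hi⟩ = i from rfl, dist_self]
      exact hδ
    · rw [merge_apply_of_le _ _ hi, Real.dist_eq]
      refine hφs i _ ?_
      rw [← hψge i hi]
      exact Finset.prod_ne_zero_iff.1 hsk i (Finset.mem_univ i)
  · have hne : navgScale j * (2 * Real.pi) ^ j ≠ 0 := by
      have := navgScale_pos j
      positivity
    refine ⟨((navgScale j * (2 * Real.pi) ^ j : ℝ) : ℂ), Complex.ofReal_ne_zero.2 hne, Lp.ext ?_⟩
    filter_upwards [navgOp_coe hj (hmem.toLp _), navg_congr hj hg, hg, Lp.coeFn_smul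
      ((navgScale j * (2 * Real.pi) ^ j : ℝ) : ℂ) (hmem.toLp _)] with k h1 h2 h3 h4
    have hsk : ∀ t : Fin j → ℝ, s (merge j t k) = s k := fun t => by
      refine Finset.prod_congr rfl fun i _ => ?_
      rcases lt_or_ge (i : ℕ) j with hi | hi
      · rw [hψlt i hi]
      · rw [merge_apply_of_le _ _ hi]
    rw [h1, h2, h4, Pi.smul_apply, h3, navg_eq, Complex.coe_smul]
    simp only [hsk]
    rw [integral_const, boxMeasure_real_univ, ← smul_smul (navgScale j)]
  · intro i hji hi
    refine Lp.ext ?_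
    filter_upwards [navgOp_coe hi (hmem.toLp _), navg_congr hi hg,
      Lp.coeFn_zero (EuclideanSpace ℂ (Fin M)) 2 (boxMeasure N)] with k h1 h2 h3
    rw [h1, h2, h3, navg_eq, integral_smul_const, Pi.zero_apply]
    have : ∫ t, s (merge i t k) ∂boxMeasure i = 0 :=
      integral_prod_merge_eq_zero hi ψ k (l := ⟨j, hji.trans_le hi⟩) hji
        (by rw [hψge _ le_rfl]; exact hφ0 _)
    rw [this, zero_smul, smul_zero]

end LocalizedModes

section Main

variable {N M : ℕ} {A : (Fin N → ℝ) → Matrix (Fin M) (Fin M) ℂ}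
  {AA : ℕ → (Fin N → ℝ) → Matrix (Fin M) (Fin M) ℂ} {lam : ℂ}

theorem det_Bseq_ne_zero_of_isUnit (hA : Continuous A)
    (hAA : ∀ j ∈ Finset.Icc 1 N, Continuous (AA j)) (hunit : IsUnit (partialOp A AA lam N))
    {j : ℕ} (hj : j ≤ N) : ∀ k ∈ box N, ((Bseq A AA lam j).1 k).det ≠ 0 := by
  induction j using Nat.strong_induction_on with
  | _ j ih =>
    intro k₀ hk₀ h0
    have hdet : ∀ i < j, ∀ k ∈ box N, ((Bseq A AA lam i).1 k).det ≠ 0 :=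
      fun i hi => ih i hi (by omega)
    obtain ⟨L, hL⟩ := exists_left_inverse_on_eigen hA hAA hj hdet hunit
    obtain ⟨g, hg0, hgε, hgj, hgi⟩ := exists_localized_mode hj (continuousOn_Bseq hA hAA hj hdet).1
      Bseq_fst_merge hk₀ h0 (ε := (‖L‖ + 1)⁻¹) (by positivity)
    have hg : 0 < ‖g‖ := norm_pos_iff.2 hg0
    have h1 : ‖g‖ ≤ ‖L‖ * ((‖L‖ + 1)⁻¹ * ‖g‖) := by
      conv_lhs => rw [hL g hgj hgi]
      exact L.le_opNorm_of_le hgε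
    have h2 : ‖L‖ * (‖L‖ + 1)⁻¹ < 1 := by
      rw [← div_eq_mul_inv, div_lt_one (by positivity)]
      linarith
    nlinarith

theorem partialOp_coe (hA : Continuous A) (hAA : ∀ j ∈ Finset.Icc 1 N, Continuous (AA j))
    {n : ℕ} (hn : n ≤ N) (f : L2M N M) :
    ∀ᵐ k ∂boxMeasure N, ∀ a : Fin M, (partialOp A AA lam n f) k a =
      (∑ b : Fin M, A k a b * f k b) - lam * f k a +
        ∑ j ∈ Finset.Icc 1 n, ∑ b : Fin M, AA j k a b * navg j (⇑f) k b := by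
  induction n with
  | zero =>
    filter_upwards [mulOp_coe (continuousOn_Bseq (lam := lam) hA hAA hn (by simp)).1 f] with k h a
    rw [partialOp, h, act_apply]
    simp [Bseq, sub_mul, Finset.sum_sub_distrib, Matrix.one_apply]
  | succ n ih =>
    filter_upwards [ih (by omega), mulOp_coe (hAA (n + 1) (Finset.mem_Icc.2
      ⟨by omega, hn⟩)).continuousOn (navgOp (n + 1) f), navgOp_coe hn f,
      Lp.coeFn_add (partialOp A AA lam n f) (mulOp (AA (n + 1)) (navgOp (n + 1) f))]
      with k h1 h2 h3 h4 a
    rw [partialOp, add_apply, mul_apply_eq_comp, h4, Pi.add_apply, PiLp.add_apply, h1, h2, h3,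
      act_apply, Finset.sum_Icc_succ_top (by omega), add_assoc]

end Main

/-- Theorem 3.1: with `B₀ = A − λI` and, recursively,
`B_j = I + ⟨B_{j-1}⁻¹⋯B₁⁻¹B₀⁻¹ A_j⟩_{1…j}` (a matrix function of `(k_{j+1},…,k_N)`;
`B_N` is constant), we have: `λ ∈ spec(Ĉ)` iff there is `j ∈ {0,…,N}` such that
`det B_i` is nowhere zero for all `i < j` while `det B_j(k) = 0` for some `k`;
equivalently, `λ ∉ spec(Ĉ)` iff every `B_j`, `j = 0,…,N`, has nowhere-vanishing
determinant. -/
theorem spectrum_characterization (N M : ℕ) (hN : 0 < N) (hM : 0 < M)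
    (A : (Fin N → ℝ) → Matrix (Fin M) (Fin M) ℂ)
    (AA : ℕ → (Fin N → ℝ) → Matrix (Fin M) (Fin M) ℂ)
    (hAcont : Continuous A)
    (hAper : ∀ (k : Fin N → ℝ) (i : Fin N),
      A (Function.update k i (k i + 2 * Real.pi)) = A k)
    (hAAcont : ∀ j ∈ Finset.Icc 1 N, Continuous (AA j))
    (hAAper : ∀ j ∈ Finset.Icc 1 N, ∀ (k : Fin N → ℝ) (i : Fin N),
      AA j (Function.update k i (k i + 2 * Real.pi)) = AA j k)
    (hAAindep : ∀ j ∈ Finset.Icc 1 N, ∀ k k' : Fin N → ℝ,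
      (∀ i : Fin N, j ≤ (i : ℕ) → k i = k' i) → AA j k = AA j k')
    (Chat : L2M N M →L[ℂ] L2M N M)
    (hChat : ∀ f : L2M N M, ∀ᵐ k ∂(boxMeasure N), ∀ a : Fin M,
      (Chat f) k a = (∑ b : Fin M, A k a b * f k b) +
        ∑ j ∈ Finset.Icc 1 N, ∑ b : Fin M, AA j k a b * navg j (⇑f) k b)
    (lam : ℂ) :
    (lam ∈ spectrum ℂ Chat ↔
      ∃ j ≤ N,
        (∀ i < j, ∀ k ∈ box N, ((Bseq A AA lam i).1 k).det ≠ 0) ∧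
        ∃ k ∈ box N, ((Bseq A AA lam j).1 k).det = 0) ∧
    (lam ∉ spectrum ℂ Chat ↔
      ∀ j ≤ N, ∀ k ∈ box N, ((Bseq A AA lam j).1 k).det ≠ 0) := by
  have hop : Chat - algebraMap ℂ (L2M N M →L[ℂ] L2M N M) lam = partialOp A AA lam N := by
    refine ContinuousLinearMap.ext fun f => Lp.ext ?_
    rw [sub_apply, Algebra.algebraMap_eq_smul_one, smul_apply, one_apply_eq_self]
    filter_upwards [hChat f, partialOp_coe (lam := lam) hAcont hAAcont le_rfl f,
      Lp.coeFn_sub (Chat f) (lam • f), Lp.coeFn_smul lam f] with k h1 h2 h3 h4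
    ext a
    rw [h3, Pi.sub_apply, PiLp.sub_apply, h4, h1, h2, Pi.smul_apply, PiLp.smul_apply, smul_eq_mul]
    ring
  have hmain : lam ∉ spectrum ℂ Chat ↔
      ∀ j ≤ N, ∀ k ∈ box N, ((Bseq A AA lam j).1 k).det ≠ 0 := by
    rw [spectrum.notMem_iff, IsUnit.sub_iff, hop]
    refine ⟨fun h j hj => det_Bseq_ne_zero_of_isUnit hAcont hAAcont h hj, fun h => ?_⟩
    obtain ⟨E, h1, h2, -⟩ := exists_inverse_partialOp hAcont hAAcont le_rfl h
    exact isUnit_iff_exists.2 ⟨E, h1, h2⟩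
  refine ⟨?_, hmain⟩
  rw [← not_iff_not, hmain]
  constructor
  · rintro h ⟨j, hj, -, k, hk, h0⟩
    exact h j hj k hk h0
  · intro h j
    induction j using Nat.strong_induction_on with
    | _ j ih =>
      exact fun hj k hk h0 => h ⟨j, hj, fun i hi => ih i hi (by omega), k, hk, h0⟩
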